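/- Let f ⊆ {0,1}^n × R be a relation. Then for every integer m ≥ 2: PDT(f ∘ IP_m) ≥ DT(f), sDT(f ∘ IP_m) ≥ DT(f), and PDTsize(f ∘ IP_m) ≥ 2^{DT(f)}. -/

import Mathlib

/-- A Boolean function `g` on coordinates `ι` is `k`-stifled if for every set `S` of at most
`k` coordinates and every target bit `b`, there is an assignment to the coordinates outside `S`
that forces the value of `g` to be `b`. -/
def Stifled {ι : Type} (g : (ι → ZMod 2) → ZMod 2) (k : ℕ) : Prop :=
  ∀ S : Finset ι, S.card ≤ k → ∀ b : ZMod 2,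
    ∃ z : ι → ZMod 2, ∀ x : ι → ZMod 2, (∀ i, i ∉ S → x i = z i) → g x = b

/-- The composed relation `f ∘ g` on inputs split into `n` blocks of coordinates `κ`. -/
def Compose {n : ℕ} {κ R : Type} (f : (Fin n → ZMod 2) → R → Prop)
    (g : (κ → ZMod 2) → ZMod 2) : ((Fin n × κ) → ZMod 2) → R → Prop :=
  fun y r => f (fun i => g fun j => y (i, j)) r

/-- Deterministic decision trees querying single coordinates. -/
inductive DTree (ι R : Type) : Type where
  | leaf (r : R) : DTree ι R
  | node (i : ι) (t0 t1 : DTree ι R) : DTree ι R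

namespace DTree

variable {ι R : Type}

def depth : DTree ι R → ℕ
  | leaf _ => 0
  | node _ t0 t1 => max (depth t0) (depth t1) + 1

def eval : DTree ι R → (ι → ZMod 2) → R
  | leaf r, _ => r
  | node i t0 t1, x => if x i = 1 then eval t1 x else eval t0 x

def Computes (T : DTree ι R) (f : (ι → ZMod 2) → R → Prop) : Prop :=
  ∀ x, f x (T.eval x)

end DTree

/-- Deterministic decision tree complexity: the minimum depth of a decision tree computing `f`. -/
noncomputable def DTdepth {ι R : Type} (f : (ι → ZMod 2) → R → Prop) : ℕ :=
  sInf {d | ∃ T : DTree ι R, T.Computes f ∧ T.depth = d}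

/-- Parity decision trees: each node queries a parity `⟨P, x⟩` over `F₂`. -/
inductive PDTree (ι R : Type) : Type where
  | leaf (r : R) : PDTree ι R
  | node (P : ι → ZMod 2) (t0 t1 : PDTree ι R) : PDTree ι R

namespace PDTree

variable {ι R : Type} [Fintype ι]

def depth {ι R : Type} : PDTree ι R → ℕ
  | leaf _ => 0
  | node _ t0 t1 => max (depth t0) (depth t1) + 1

/-- The number of leaves of a parity decision tree. -/
def size {ι R : Type} : PDTree ι R → ℕ
  | leaf _ => 1
  | node _ t0 t1 => size t0 + size t1

def eval : PDTree ι R → (ι → ZMod 2) → R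
  | leaf r, _ => r
  | node P t0 t1, x => if (∑ i, P i * x i) = 1 then eval t1 x else eval t0 x

def Computes (T : PDTree ι R) (f : (ι → ZMod 2) → R → Prop) : Prop :=
  ∀ x, f x (T.eval x)

end PDTree

/-- Parity decision tree depth complexity. -/
noncomputable def PDTdepth {ι R : Type} [Fintype ι] (f : (ι → ZMod 2) → R → Prop) : ℕ :=
  sInf {d | ∃ T : PDTree ι R, T.Computes f ∧ T.depth = d}

/-- Parity decision tree size complexity: the minimum number of leaves of a PDT computing `f`. -/
noncomputable def PDTsizeMin {ι R : Type} [Fintype ι] (f : (ι → ZMod 2) → R → Prop) : ℕ :=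
  sInf {s | ∃ T : PDTree ι R, T.Computes f ∧ T.size = s}

/-- Subspace decision trees: each node queries membership in an affine subspace of `F₂^ι`. -/
inductive SDTree (ι R : Type) : Type where
  | leaf (r : R) : SDTree ι R
  | node (A : AffineSubspace (ZMod 2) (ι → ZMod 2)) (t0 t1 : SDTree ι R) : SDTree ι R

namespace SDTree

variable {ι R : Type}

def depth : SDTree ι R → ℕ
  | leaf _ => 0
  | node _ t0 t1 => max (depth t0) (depth t1) + 1

open Classical in
noncomputable def eval : SDTree ι R → (ι → ZMod 2) → R
  | leaf r, _ => r
  | node A t0 t1, x => if x ∈ A then eval t1 x else eval t0 x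

def Computes (T : SDTree ι R) (f : (ι → ZMod 2) → R → Prop) : Prop :=
  ∀ x, f x (T.eval x)

end SDTree

/-- Subspace decision tree depth complexity. -/
noncomputable def SDTdepth {ι R : Type} (f : (ι → ZMod 2) → R → Prop) : ℕ :=
  sInf {d | ∃ T : SDTree ι R, T.Computes f ∧ T.depth = d}

/-- A non-adaptive decision tree with `q` queries `qs` (fixed in advance) computes `f`
if the output, a function of the answers only, is always a valid value for `f`. -/
def NADTComputes {ι R : Type} (q : ℕ) (qs : Fin q → ι)
    (out : (Fin q → ZMod 2) → R) (f : (ι → ZMod 2) → R → Prop) : Prop :=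
  ∀ x, f x (out fun t => x (qs t))

/-- Non-adaptive decision tree complexity: the minimum number of (fixed) queries. -/
noncomputable def NADT {ι R : Type} (f : (ι → ZMod 2) → R → Prop) : ℕ :=
  sInf {q | ∃ qs : Fin q → ι, ∃ out : (Fin q → ZMod 2) → R, NADTComputes q qs out f}

/-- A non-adaptive parity decision tree with `q` parity queries `qs` (fixed in advance)
computes `f` if the output, a function of the parity answers only, is always valid for `f`. -/
def NAPDTComputes {ι R : Type} [Fintype ι] (q : ℕ) (qs : Fin q → ι → ZMod 2)
    (out : (Fin q → ZMod 2) → R) (f : (ι → ZMod 2) → R → Prop) : Prop :=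
  ∀ x, f x (out fun t => ∑ i, qs t i * x i)

/-- The number `bin x ∈ [2^m]` represented by the binary expansion `x`. -/
def binIndex {m : ℕ} (x : Fin m → ZMod 2) : Fin (2 ^ m) :=
  finFunctionFinEquiv fun i => (⟨(x i).val, ZMod.val_lt (x i)⟩ : Fin 2)

/-- The Indexing function: `m` addressing variables select one of `2^m` target variables. -/
def IND (m : ℕ) : ((Fin m ⊕ Fin (2 ^ m)) → ZMod 2) → ZMod 2 :=
  fun w => w (Sum.inr (binIndex fun i => w (Sum.inl i)))

/-- The Inner Product Modulo 2 function on `2m` bits. -/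
def IP (m : ℕ) : ((Fin m ⊕ Fin m) → ZMod 2) → ZMod 2 :=
  fun w => ∑ i : Fin m, w (Sum.inl i) * w (Sum.inr i)

/-- The Majority function: `1` iff at least `n/2` of the `n` input bits are `1`. -/
def MAJ (n : ℕ) : (Fin n → ZMod 2) → ZMod 2 :=
  fun x => if n ≤ 2 * (Finset.univ.filter fun i => x i = 1).card then 1 else 0

/-- Maps preserving ternary sums; over `F₂` these are exactly the affine maps. -/
def Aff3 {V W : Type} [Add V] [Add W] (h : V → W) : Prop :=
  ∀ a b c, h (a + b + c) = h a + h b + h c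

theorem z2_add_self {α : Type} (x : α → ZMod 2) : x + x = 0 := by
  funext i
  exact CharTwo.add_self_eq_zero (x i)

theorem z2_cases (a : ZMod 2) : a = 0 ∨ a = 1 := by
  revert a; decide

theorem z2_eq_of_add {a b : ZMod 2} (h : a + b = 0) : a = b := by
  revert a b; decide

theorem z2_flip {c a u v : ZMod 2} (h : c + a = 1) (h' : u ≠ v) : a + u + v = c := by
  revert c a u v; decide

/-- A non-constant affine functional is flipped by some unit vector. -/
theorem exists_flip {α : Type} [Fintype α] [DecidableEq α] (k : (α → ZMod 2) → ZMod 2)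
    (hk : Aff3 k) (hne : ∃ y y', k y ≠ k y') :
    ∃ a, k (Pi.single a 1) ≠ k 0 := by
  by_contra! hc
  obtain ⟨y, y', hyy⟩ := hne
  have hc2 : ∀ u : ZMod 2, u + u = 0 := by decide
  let l : (α → ZMod 2) →+ ZMod 2 :=
    { toFun := fun v => k v + k 0
      map_zero' := hc2 _
      map_add' := by
        intro v w
        have := hk v w 0
        rw [add_zero] at this
        rw [this]
        generalize k v = a
        generalize k w = b
        generalize k 0 = c
        revert a b c; decide }
  have hl : l = 0 := by
    refine AddMonoidHom.functions_ext _ _ _ ?_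
    intro i x
    rcases z2_cases x with rfl | rfl
    · simp
    · change k (Pi.single i 1) + k 0 = 0
      rw [hc, hc2]
  have key : ∀ v, k v = k 0 := by
    intro v
    have : k v + k 0 = 0 := DFunLike.congr_fun hl v
    exact z2_eq_of_add this
  have e1 := key y'
  have e2 := key y
  exact hyy (e2.trans e1.symm)

/-- Invariant of the simulation. -/
structure SimState {n : ℕ} {κ : Type} (g : (κ → ZMod 2) → ZMod 2)
    (L : ((Fin n × κ) → ZMod 2) → ((Fin n × κ) → ZMod 2))
    (F : Finset (Fin n)) (ρ : Fin n → ZMod 2) : Prop where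
  aff : Aff3 L
  free : ∀ y, ∀ i ∈ F, ∀ j, L y (i, j) = y (i, j)
  fixed : ∀ i, i ∉ F → ∀ y, g (fun j => L y (i, j)) = ρ i
  dep : ∀ y y', (∀ i ∈ F, ∀ j, y (i, j) = y' (i, j)) → L y = L y'

theorem sim_step {n : ℕ} {κ : Type} [Fintype κ] [DecidableEq κ]
    {g : (κ → ZMod 2) → ZMod 2} (hg : Stifled g 1)
    {L : ((Fin n × κ) → ZMod 2) → ((Fin n × κ) → ZMod 2)}
    {F : Finset (Fin n)} {ρ : Fin n → ZMod 2} (hS : SimState g L F ρ)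
    (h : ((Fin n × κ) → ZMod 2) → ZMod 2) (hh : Aff3 h)
    (hne : ∃ y y', h (L y) ≠ h (L y')) :
    ∃ i ∈ F, ∀ b c, ∃ L', SimState g L' (F.erase i) (Function.update ρ i b) ∧
      ∀ y, h (L' y) = c ∧ ∃ y', L' y = L y' := by
  have hk : Aff3 (fun y => h (L y)) := by
    intro a b c
    change h (L (a + b + c)) = _
    rw [hS.aff, hh]
  obtain ⟨⟨i, j⟩, hij⟩ := exists_flip _ hk hne
  have hiF : i ∈ F := by
    by_contra hi
    apply hij
    change h (L _) = h (L _)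
    rw [hS.dep (Pi.single (i, j) 1) 0]
    intro i' hi' j'
    rw [Pi.single_eq_of_ne]
    · rfl
    · intro e
      apply hi
      have : i' = i := congrArg Prod.fst e
      exact this ▸ hi'
  refine ⟨i, hiF, fun b c => ?_⟩
  obtain ⟨z, hz⟩ := hg {j} (by simp) b
  -- substitute the stifling assignment in block `i`
  let N : ((Fin n × κ) → ZMod 2) → ((Fin n × κ) → ZMod 2) :=
    fun y p => if p.1 = i then z p.2 else y p
  let e : (Fin n × κ) → ZMod 2 := Pi.single (i, j) 1
  let M : ((Fin n × κ) → ZMod 2) → ((Fin n × κ) → ZMod 2) :=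
    fun y => N y + (c + h (L (N y))) • e
  have hN : Aff3 N := by
    intro u v w
    funext p
    by_cases hp : p.1 = i
    · simp only [N, hp, Pi.add_apply, if_true]
      generalize z p.2 = a
      revert a; decide
    · simp [N, hp]
  have hM : Aff3 M := by
    intro u v w
    funext p
    have h1 := congrFun (hN u v w) p
    have h2 := hk (N u) (N v) (N w)
    simp only at h2
    simp only [M, Pi.add_apply, Pi.smul_apply, smul_eq_mul] at h1 ⊢
    rw [h1, hN u v w, h2]
    generalize N u p = a1
    generalize N v p = a2
    generalize N w p = a3
    generalize h (L (N u)) = a4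
    generalize h (L (N v)) = a5
    generalize h (L (N w)) = a6
    generalize e p = a7
    have h2' : (2 : ZMod 2) = 0 := by decide
    linear_combination (-(c * a7)) * h2'
  have hMother : ∀ y p, p ≠ (i, j) → M y p = N y p := by
    intro y p hp
    simp [M, e, Pi.single_eq_of_ne hp]
  refine ⟨fun y => L (M y), ⟨?_, ?_, ?_, ?_⟩, ?_⟩
  · intro u v w
    change L (M _) = _
    rw [hM, hS.aff]
  · intro y i' hi' j'
    rw [Finset.mem_erase] at hi'
    change L (M y) (i', j') = _
    rw [hS.free _ _ hi'.2, hMother _ _ (by intro e'; exact hi'.1 (congrArg Prod.fst e'))]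
    simp [N, hi'.1]
  · intro i' hi' y
    by_cases hii : i' = i
    · subst hii
      rw [Function.update_self]
      apply hz
      intro j' hj'
      change L (M y) (i', j') = _
      rw [hS.free _ _ hiF, hMother]
      · simp [N]
      · intro e'
        apply hj'
        rw [Finset.mem_singleton]
        exact congrArg Prod.snd e'
    · rw [Function.update_of_ne hii]
      apply hS.fixed
      intro hF
      exact hi' (Finset.mem_erase.2 ⟨hii, hF⟩)
  · intro y y' hyy
    have hLN : L (N y) = L (N y') := by
      apply hS.dep
      intro i' hi' j'
      by_cases hii : i' = i
      · simp [N, hii]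
      · simp only [N, hii, if_false]
        exact hyy i' (Finset.mem_erase.2 ⟨hii, hi'⟩) j'
    apply hS.dep
    intro i' hi' j'
    simp only [M, Pi.add_apply, hLN]
    congr 1
    by_cases hii : i' = i
    · simp [N, hii]
    · simp only [N, hii, if_false]
      exact hyy i' (Finset.mem_erase.2 ⟨hii, hi'⟩) j'
  · intro y
    refine ⟨?_, M y, rfl⟩
    change h (L (M y)) = c
    rcases z2_cases (c + h (L (N y))) with h0 | h1
    · simp only [M, h0, zero_smul, add_zero]
      exact (z2_eq_of_add h0).symm
    · simp only [M, h1, one_smul]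
      have h2 := hk (N y) e 0
      simp only [add_zero] at h2
      rw [h2]
      change h (L e) ≠ h (L 0) at hij
      exact z2_flip h1 hij

theorem sim_leaf {n : ℕ} {κ R : Type} {g : (κ → ZMod 2) → ZMod 2} (hg : Stifled g 1)
    {f : (Fin n → ZMod 2) → R → Prop}
    {L : ((Fin n × κ) → ZMod 2) → ((Fin n × κ) → ZMod 2)}
    {F : Finset (Fin n)} {ρ : Fin n → ZMod 2} (hS : SimState g L F ρ) (r : R)
    (hf : ∀ y, Compose f g (L y) r) (x : Fin n → ZMod 2) (hx : ∀ i, i ∉ F → x i = ρ i) :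
    f x r := by
  have hs : ∀ b, ∃ z, g z = b := by
    intro b
    obtain ⟨z, hz⟩ := hg ∅ (by simp) b
    exact ⟨z, hz z fun _ _ => rfl⟩
  choose s hs using hs
  have := hf (fun p => s (x p.1) p.2)
  unfold Compose at this
  convert this using 1
  funext i
  by_cases hi : i ∈ F
  · simp only [hS.free _ i hi]
    exact (hs (x i)).symm
  · rw [hS.fixed i hi, hx i hi]

/-- Combining the decision trees for the two values of the queried bit. -/
theorem node_correct {n : ℕ} {R : Type} {f : (Fin n → ZMod 2) → R → Prop}
    {F : Finset (Fin n)} {ρ : Fin n → ZMod 2} {i : Fin n} (hi : i ∈ F)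
    {D : ZMod 2 → DTree (Fin n) R}
    (hD : ∀ b x, (∀ i', i' ∉ F.erase i → x i' = Function.update ρ i b i') → f x ((D b).eval x))
    (x : Fin n → ZMod 2) (hx : ∀ i, i ∉ F → x i = ρ i) :
    f x ((DTree.node i (D 0) (D 1)).eval x) := by
  have key : f x ((D (x i)).eval x) := by
    apply hD
    intro i' hi'
    by_cases hii : i' = i
    · subst hii; simp
    · rw [Function.update_of_ne hii]
      apply hx
      intro hF
      exact hi' (Finset.mem_erase.2 ⟨hii, hF⟩)
  unfold DTree.eval
  rcases z2_cases (x i) with h | h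
  · rw [h] at key; simpa [h] using key
  · rw [h] at key; simpa [h] using key

theorem pdt_sim {n : ℕ} {κ R : Type} [Fintype κ] [DecidableEq κ]
    {g : (κ → ZMod 2) → ZMod 2} (hg : Stifled g 1) (f : (Fin n → ZMod 2) → R → Prop)
    (T : PDTree (Fin n × κ) R) :
    ∀ (L : ((Fin n × κ) → ZMod 2) → ((Fin n × κ) → ZMod 2))
      (F : Finset (Fin n)) (ρ : Fin n → ZMod 2), SimState g L F ρ →
      (∀ y, Compose f g (L y) (T.eval (L y))) →
      ∃ D : DTree (Fin n) R, (∀ x, (∀ i, i ∉ F → x i = ρ i) → f x (D.eval x)) ∧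
        2 ^ D.depth ≤ T.size := by
  induction T with
  | leaf r =>
    intro L F ρ hS hf
    exact ⟨DTree.leaf r, fun x hx => sim_leaf hg hS r hf x hx, by simp [DTree.depth, PDTree.size]⟩
  | node P t0 t1 ih0 ih1 =>
    intro L F ρ hS hf
    let h : ((Fin n × κ) → ZMod 2) → ZMod 2 := fun x => ∑ p, P p * x p
    have hh : Aff3 h := by
      intro a b c
      simp only [h, Pi.add_apply, mul_add, Finset.sum_add_distrib]
    have hf1 : ∀ y, h (L y) = 1 → Compose f g (L y) (t1.eval (L y)) := by
      intro y hy
      have := hf y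
      rw [PDTree.eval, if_pos hy] at this
      exact this
    have hf0 : ∀ y, h (L y) = 0 → Compose f g (L y) (t0.eval (L y)) := by
      intro y hy
      have := hf y
      rw [PDTree.eval, if_neg (by change h (L y) ≠ 1; rw [hy]; decide)] at this
      exact this
    by_cases hne : ∃ y y', h (L y) ≠ h (L y')
    · obtain ⟨i, hi, hstep⟩ := sim_step hg hS h hh hne
      have main : ∀ (t : PDTree (Fin n × κ) R) (c : ZMod 2), 2 * t.size ≤ t0.size + t1.size →
          (∀ (L : ((Fin n × κ) → ZMod 2) → ((Fin n × κ) → ZMod 2))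
            (F : Finset (Fin n)) (ρ : Fin n → ZMod 2), SimState g L F ρ →
            (∀ y, Compose f g (L y) (t.eval (L y))) →
            ∃ D : DTree (Fin n) R, (∀ x, (∀ i, i ∉ F → x i = ρ i) → f x (D.eval x)) ∧
              2 ^ D.depth ≤ t.size) →
          (∀ y, h (L y) = c → Compose f g (L y) (t.eval (L y))) →
          ∃ D : DTree (Fin n) R, (∀ x, (∀ i, i ∉ F → x i = ρ i) → f x (D.eval x)) ∧
            2 ^ D.depth ≤ (PDTree.node P t0 t1).size := by
        intro t c hsz ih hft
        have : ∀ b, ∃ D : DTree (Fin n) R,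
            (∀ x, (∀ i', i' ∉ F.erase i → x i' = Function.update ρ i b i') → f x (D.eval x)) ∧
              2 ^ D.depth ≤ t.size := by
          intro b
          obtain ⟨L', hS', hL'⟩ := hstep b c
          refine ih L' _ _ hS' ?_
          intro y
          obtain ⟨hc, y', hy'⟩ := hL' y
          rw [hy'] at hc ⊢
          exact hft y' hc
        choose D hD hsize using this
        refine ⟨DTree.node i (D 0) (D 1), node_correct hi hD, ?_⟩
        rw [DTree.depth, PDTree.size, pow_succ]
        have : 2 ^ max (D 0).depth (D 1).depth ≤ t.size := by
          rcases max_choice (D 0).depth (D 1).depth with hm | hm <;> rw [hm]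
          · exact hsize 0
          · exact hsize 1
        omega
      rcases le_total t0.size t1.size with hle | hle
      · exact main t0 0 (by omega) ih0 hf0
      · exact main t1 1 (by omega) ih1 hf1
    · push Not at hne
      rcases z2_cases (h (L 0)) with h0 | h0
      · obtain ⟨D, hD, hs⟩ := ih0 L F ρ hS (fun y => hf0 y ((hne y 0).trans h0))
        exact ⟨D, hD, by rw [PDTree.size]; omega⟩
      · obtain ⟨D, hD, hs⟩ := ih1 L F ρ hS (fun y => hf1 y ((hne y 0).trans h0))
        exact ⟨D, hD, by rw [PDTree.size]; omega⟩

/-- A point outside an affine subspace is separated by an affine functional. -/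
theorem exists_sep {α : Type} (A : AffineSubspace (ZMod 2) (α → ZMod 2)) (q : α → ZMod 2)
    (hq : q ∉ A) :
    ∃ h : (α → ZMod 2) → ZMod 2, Aff3 h ∧ h q = 1 ∧ ∀ x ∈ A, h x = 0 := by
  by_cases hA : ∃ p, p ∈ A
  · obtain ⟨p, hp⟩ := hA
    have hd : q - p ∉ A.direction := by
      intro hd
      apply hq
      have := AffineSubspace.vadd_mem_of_mem_direction hd hp
      simpa using this
    obtain ⟨φ, hφ, hle⟩ := Submodule.exists_le_ker_of_notMem hd
    refine ⟨fun x => φ (x - p), ?_, ?_, ?_⟩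
    · intro a b c
      simp only [map_sub, map_add]
      generalize φ p = d
      have h2' : (2 : ZMod 2) = 0 := by decide
      linear_combination d * h2'
    · rcases z2_cases (φ (q - p)) with h | h
      · exact absurd h hφ
      · exact h
    · intro x hx
      exact hle (AffineSubspace.vsub_mem_direction hx hp)
  · push Not at hA
    refine ⟨fun _ => 1, ?_, rfl, fun x hx => absurd hx (hA x)⟩
    intro a b c
    change (1 : ZMod 2) = 1 + 1 + 1
    decide

theorem sdt_sim {n : ℕ} {κ R : Type} [Fintype κ] [DecidableEq κ]
    {g : (κ → ZMod 2) → ZMod 2} (hg : Stifled g 1) (f : (Fin n → ZMod 2) → R → Prop)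
    (T : SDTree (Fin n × κ) R) :
    ∀ (L : ((Fin n × κ) → ZMod 2) → ((Fin n × κ) → ZMod 2))
      (F : Finset (Fin n)) (ρ : Fin n → ZMod 2), SimState g L F ρ →
      (∀ y, Compose f g (L y) (T.eval (L y))) →
      ∃ D : DTree (Fin n) R, (∀ x, (∀ i, i ∉ F → x i = ρ i) → f x (D.eval x)) ∧
        D.depth ≤ T.depth := by
  induction T with
  | leaf r =>
    intro L F ρ hS hf
    exact ⟨DTree.leaf r, fun x hx => sim_leaf hg hS r hf x hx, by simp [DTree.depth]⟩
  | node A t0 t1 ih0 ih1 =>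
    intro L F ρ hS hf
    by_cases hall : ∀ y, L y ∈ A
    · obtain ⟨D, hD, hs⟩ := ih1 L F ρ hS (fun y => by
        have := hf y
        rw [SDTree.eval, if_pos (hall y)] at this
        exact this)
      exact ⟨D, hD, by rw [SDTree.depth]; omega⟩
    · push Not at hall
      obtain ⟨q, hq⟩ := hall
      obtain ⟨h, hh, hq1, hA⟩ := exists_sep A _ hq
      have hf0 : ∀ y, h (L y) = 1 → Compose f g (L y) (t0.eval (L y)) := by
        intro y hy
        have := hf y
        rw [SDTree.eval, if_neg (by
          intro hm
          rw [hA _ hm] at hy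
          exact absurd hy (by decide))] at this
        exact this
      by_cases hne : ∃ y y', h (L y) ≠ h (L y')
      · obtain ⟨i, hi, hstep⟩ := sim_step hg hS h hh hne
        have : ∀ b, ∃ D : DTree (Fin n) R,
            (∀ x, (∀ i', i' ∉ F.erase i → x i' = Function.update ρ i b i') → f x (D.eval x)) ∧
              D.depth ≤ t0.depth := by
          intro b
          obtain ⟨L', hS', hL'⟩ := hstep b 1
          refine ih0 L' _ _ hS' ?_
          intro y
          obtain ⟨hc, y', hy'⟩ := hL' y
          rw [hy'] at hc ⊢
          exact hf0 y' hc
        choose D hD hdep using this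
        refine ⟨DTree.node i (D 0) (D 1), node_correct hi hD, ?_⟩
        rw [DTree.depth, SDTree.depth]
        have h0 := hdep 0
        have h1 := hdep 1
        omega
      · push Not at hne
        obtain ⟨D, hD, hs⟩ := ih0 L F ρ hS (fun y => hf0 y ((hne y q).trans hq1))
        exact ⟨D, hD, by rw [SDTree.depth]; omega⟩

theorem IP_stifled (m : ℕ) (hm : 2 ≤ m) : Stifled (IP m) 1 := by
  intro S hS b
  haveI : Nonempty (Fin m ⊕ Fin m) := ⟨Sum.inl ⟨0, by omega⟩⟩
  -- a position `a` such that `S` is contained in the pair of coordinates at position `a`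
  obtain ⟨a, ha⟩ : ∃ a : Fin m, ∀ s ∈ S, s = Sum.inl a ∨ s = Sum.inr a := by
    rcases Finset.card_le_one_iff_subset_singleton.1 hS with ⟨s, hs⟩
    rcases s with a | a
    · exact ⟨a, fun s' h' => Or.inl (Finset.mem_singleton.1 (hs h'))⟩
    · exact ⟨a, fun s' h' => Or.inr (Finset.mem_singleton.1 (hs h'))⟩
  obtain ⟨a', ha'⟩ : ∃ a' : Fin m, a' ≠ a := by
    haveI : Nontrivial (Fin m) := Fin.nontrivial_iff_two_le.2 hm
    exact exists_ne a
  refine ⟨Sum.elim (fun i => if i = a' then 1 else 0) (fun i => if i = a' then b else 0), ?_⟩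
  intro x hx
  unfold IP
  rw [Finset.sum_eq_single a']
  · rw [hx (Sum.inl a'), hx (Sum.inr a')]
    · simp
    · intro hmem
      rcases ha _ hmem with h | h
      · cases h
      · exact ha' (Sum.inr.inj h)
    · intro hmem
      rcases ha _ hmem with h | h
      · exact ha' (Sum.inl.inj h)
      · cases h
  · intro i _ hi
    have : Sum.inl i ∉ S ∨ Sum.inr i ∉ S := by
      by_contra! hc
      have := Finset.card_le_one.1 hS _ hc.1 _ hc.2
      cases this
    rcases this with h | h
    · rw [hx _ h]; simp [hi]
    · rw [hx _ h]; simp [hi]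
  · intro h; exact absurd (Finset.mem_univ _) h

theorem sim_init {n : ℕ} {κ : Type} (g : (κ → ZMod 2) → ZMod 2) :
    SimState (n := n) g (fun y => y) Finset.univ 0 where
  aff := fun _ _ _ => rfl
  free := fun _ _ _ _ => rfl
  fixed := fun i hi => absurd (Finset.mem_univ i) hi
  dep := fun _ _ h => funext fun p => h p.1 (Finset.mem_univ _) p.2

theorem DTdepth_le {ι R : Type} {f : (ι → ZMod 2) → R → Prop} (D : DTree ι R)
    (hD : D.Computes f) : DTdepth f ≤ D.depth :=
  Nat.sInf_le ⟨D, hD, rfl⟩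

theorem pdt_size_le {ι R : Type} (T : PDTree ι R) : T.size ≤ 2 ^ T.depth := by
  induction T with
  | leaf r => simp [PDTree.size, PDTree.depth]
  | node P t0 t1 ih0 ih1 =>
    rw [PDTree.size, PDTree.depth, pow_succ]
    have h0 : 2 ^ t0.depth ≤ 2 ^ max t0.depth t1.depth :=
      Nat.pow_le_pow_right (by norm_num) (le_max_left _ _)
    have h1 : 2 ^ t1.depth ≤ 2 ^ max t0.depth t1.depth :=
      Nat.pow_le_pow_right (by norm_num) (le_max_right _ _)
    omega

/-- For every relation `f` and integer `m ≥ 2`: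
`PDT(f ∘ IP_m) ≥ DT(f)`, `sDT(f ∘ IP_m) ≥ DT(f)`, and `PDTsize(f ∘ IP_m) ≥ 2^(DT(f))`. -/
theorem IP_lifting {n : ℕ} {R : Type} (f : (Fin n → ZMod 2) → R → Prop)
    (m : ℕ) (hm : 2 ≤ m) :
    (∀ T : PDTree (Fin n × (Fin m ⊕ Fin m)) R,
        T.Computes (Compose f (IP m)) → DTdepth f ≤ T.depth) ∧
    (∀ T : SDTree (Fin n × (Fin m ⊕ Fin m)) R,
        T.Computes (Compose f (IP m)) → DTdepth f ≤ T.depth) ∧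
    (∀ T : PDTree (Fin n × (Fin m ⊕ Fin m)) R,
        T.Computes (Compose f (IP m)) → 2 ^ DTdepth f ≤ T.size) := by
  have hsize : ∀ T : PDTree (Fin n × (Fin m ⊕ Fin m)) R,
      T.Computes (Compose f (IP m)) → 2 ^ DTdepth f ≤ T.size := by
    intro T hT
    obtain ⟨D, hD, hs⟩ := pdt_sim (IP_stifled m hm) f T _ _ _ (sim_init _) hT
    refine le_trans (Nat.pow_le_pow_right (by norm_num) (DTdepth_le D ?_)) hs
    intro x
    exact hD x fun i hi => absurd (Finset.mem_univ i) hi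
  refine ⟨?_, ?_, hsize⟩
  · intro T hT
    exact (Nat.pow_le_pow_iff_right (by norm_num)).1 ((hsize T hT).trans (pdt_size_le T))
  · intro T hT
    obtain ⟨D, hD, hs⟩ := sdt_sim (IP_stifled m hm) f T _ _ _ (sim_init _) hT
    refine le_trans (DTdepth_le D ?_) hs
    intro x
    exact hD x fun i hi => absurd (Finset.mem_univ i) hi
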